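/- arXiv:1410.2277 — 4 statements merged into one kernel-verified Lean document; each statement's English description precedes it below -/
import Mathlib

section
/- Let A⁺, A⁻ ∈ ℂⁿˣⁿ be Hermitian with A⁺ positive semidefinite and A⁻ negative semidefinite, and set A = A⁺ + A⁻. Let c, s ∈ ℝ and x, z ∈ ℂⁿ. If Re(xᴴ A⁺ x) + 2 Re(zᴴ A⁻ x) ≤ c + Re(zᴴ A⁻ z) + s, then Re(xᴴ A x) ≤ c + s. That is, the linearized constraint (5) is a restriction of the original quadratic constraint xᴴ A x ≤ c + s. -/
open Matrix

/-- The linearized constraint (5) is a restriction of the original quadratic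
constraint `xᴴ A x ≤ c + s`, where `A = A⁺ + A⁻` with `A⁺ ⪰ 0`, `A⁻ ⪯ 0`. -/
theorem fpp_sca_restriction {n : ℕ} (Ap An : Matrix (Fin n) (Fin n) ℂ)
    (hAp : Ap.IsHermitian) (hAn : An.IsHermitian)
    (hPSD : ∀ v : Fin n → ℂ, 0 ≤ (star v ⬝ᵥ Ap *ᵥ v).re)
    (hNSD : ∀ v : Fin n → ℂ, (star v ⬝ᵥ An *ᵥ v).re ≤ 0)
    (c s : ℝ) (x z : Fin n → ℂ)
    (h : (star x ⬝ᵥ Ap *ᵥ x).re + 2 * (star z ⬝ᵥ An *ᵥ x).re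
        ≤ c + (star z ⬝ᵥ An *ᵥ z).re + s) :
    (star x ⬝ᵥ (Ap + An) *ᵥ x).re ≤ c + s := by
  have h1 := hNSD (x - z)
  have h2 : (star x ⬝ᵥ An *ᵥ z).re = (star z ⬝ᵥ An *ᵥ x).re := by
    have : star (star z ⬝ᵥ An *ᵥ x) = star x ⬝ᵥ An *ᵥ z := by
      rw [star_dotProduct, star_star, star_mulVec, hAn.eq, dotProduct_mulVec]
    rw [← this]
    simp
  simp only [star_sub, mulVec_sub, sub_dotProduct, dotProduct_sub, Complex.sub_re] at h1
  rw [add_mulVec, dotProduct_add, Complex.add_re]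
  linarith
end

section
/- Let A⁺, A⁻ ∈ ℂⁿˣⁿ be Hermitian with A⁺ positive semidefinite and A⁻ negative semidefinite, and fix z ∈ ℂⁿ. Viewing ℂⁿ as a real vector space, the surrogate f(x) = Re(xᴴ A⁺ x) + 2 Re(zᴴ A⁻ x) − Re(zᴴ A⁻ z) and the quadratic form g(x) = Re(xᴴ A x), with A = A⁺ + A⁻, have equal real Fréchet derivatives at the point x = z: fderiv ℝ f z = fderiv ℝ g z. -/
open Matrix

theorem aux_diff {n : ℕ} (M : Matrix (Fin n) (Fin n) ℂ) (z : Fin n → ℂ) :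
    Differentiable ℝ (fun x : Fin n → ℂ => (star (x - z) ⬝ᵥ M *ᵥ (x - z)).re) := by
  have h : Differentiable ℝ (fun x : Fin n → ℂ => star (x - z) ⬝ᵥ M *ᵥ (x - z)) := by
    simp only [dotProduct, mulVec, Pi.star_apply, Pi.sub_apply]
    refine Differentiable.fun_sum fun i _ => Differentiable.mul ?_ ?_
    · exact Differentiable.star (by fun_prop)
    · fun_prop
  exact Complex.reCLM.differentiable.comp h

theorem aux_lin {n : ℕ} (M : Matrix (Fin n) (Fin n) ℂ) (z : Fin n → ℂ) :
    Differentiable ℝ (fun x : Fin n → ℂ => (star z ⬝ᵥ M *ᵥ x).re) := by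
  have h : Differentiable ℝ (fun x : Fin n → ℂ => star z ⬝ᵥ M *ᵥ x) := by
    simp only [dotProduct, mulVec]
    fun_prop
  exact Complex.reCLM.differentiable.comp h

theorem aux_symm {n : ℕ} (M : Matrix (Fin n) (Fin n) ℂ) (hM : M.IsHermitian)
    (x z : Fin n → ℂ) : (star x ⬝ᵥ M *ᵥ z).re = (star z ⬝ᵥ M *ᵥ x).re := by
  have h : star (star z ⬝ᵥ M *ᵥ x) = star x ⬝ᵥ M *ᵥ z := by
    rw [← star_dotProduct_star, star_star, star_mulVec, hM.eq, dotProduct_mulVec]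
    try rw [dotProduct_comm]
  rw [← h]
  simp

/-- The surrogate `f` and the quadratic form `g` have equal real Fréchet
derivatives at the linearization point `z`. -/
theorem fpp_sca_surrogate_fderiv_eq {n : ℕ} (Ap An : Matrix (Fin n) (Fin n) ℂ)
    (hAp : Ap.IsHermitian) (hAn : An.IsHermitian)
    (hPSD : ∀ v : Fin n → ℂ, 0 ≤ (star v ⬝ᵥ Ap *ᵥ v).re)
    (hNSD : ∀ v : Fin n → ℂ, (star v ⬝ᵥ An *ᵥ v).re ≤ 0)
    (z : Fin n → ℂ) :
    fderiv ℝ (fun x : Fin n → ℂ =>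
        (star x ⬝ᵥ Ap *ᵥ x).re + 2 * (star z ⬝ᵥ An *ᵥ x).re
          - (star z ⬝ᵥ An *ᵥ z).re) z
      = fderiv ℝ (fun x : Fin n → ℂ => (star x ⬝ᵥ (Ap + An) *ᵥ x).re) z := by
  have hq := aux_diff An z
  have hp : Differentiable ℝ (fun x : Fin n → ℂ => (star x ⬝ᵥ Ap *ᵥ x).re) := by
    simpa using aux_diff Ap 0
  have hl := aux_lin An z
  have h0 : fderiv ℝ (fun x : Fin n → ℂ => (star (x - z) ⬝ᵥ An *ᵥ (x - z)).re) z = 0 := by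
    apply IsLocalMax.fderiv_eq_zero
    refine Filter.Eventually.of_forall fun x => ?_
    simpa using hNSD (x - z)
  have hf : DifferentiableAt ℝ (fun x : Fin n → ℂ =>
        (star x ⬝ᵥ Ap *ᵥ x).re + 2 * (star z ⬝ᵥ An *ᵥ x).re
          - (star z ⬝ᵥ An *ᵥ z).re) z :=
    ((hp.add (hl.const_mul 2)).sub_const _) z
  have e : (fun x : Fin n → ℂ => (star x ⬝ᵥ (Ap + An) *ᵥ x).re) =
      (fun x : Fin n → ℂ => (star x ⬝ᵥ Ap *ᵥ x).re + 2 * (star z ⬝ᵥ An *ᵥ x).re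
          - (star z ⬝ᵥ An *ᵥ z).re) +
      (fun x : Fin n → ℂ => (star (x - z) ⬝ᵥ An *ᵥ (x - z)).re) := by
    funext x
    have := aux_symm An hAn x z
    simp only [Pi.add_apply, add_mulVec, mulVec_sub, star_sub, dotProduct_add, dotProduct_sub,
      sub_dotProduct, Complex.add_re, Complex.sub_re]
    linarith
  rw [e, fderiv_add hf (hq z), h0, add_zero]
end

section
/- Fix M Hermitian matrices A₁,…,A_M ∈ ℂⁿˣⁿ with decompositions Aₘ = Aₘ⁺ + Aₘ⁻, where each Aₘ⁺ is Hermitian positive semidefinite and each Aₘ⁻ is Hermitian negative semidefinite, and fix c ∈ ℝᴹ. Suppose x, z ∈ ℂⁿ and s ∈ ℝᴹ with sₘ ≥ 0 satisfy, for every m, the linearized constraint around z: Re(xᴴ Aₘ⁺ x) + 2 Re(zᴴ Aₘ⁻ x) ≤ cₘ + Re(zᴴ Aₘ⁻ z) + sₘ. Then (x, s) also satisfies, for every m, the linearized constraint around x itself: Re(xᴴ Aₘ⁺ x) + 2 Re(xᴴ Aₘ⁻ x) ≤ cₘ + Re(xᴴ Aₘ⁻ x) + sₘ. In other words, the solution of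 the k-th FPP-SCA subproblem is feasible, with the same slacks, for the (k+1)-th subproblem linearized around it. -/
open Matrix

/-- The solution of the `k`-th FPP-SCA subproblem (linearized around `z`) is
feasible, with the same slacks, for the subproblem linearized around itself. -/
theorem fpp_sca_successive_feasibility {n M : ℕ}
    (Ap An : Fin M → Matrix (Fin n) (Fin n) ℂ)
    (hAp : ∀ m, (Ap m).IsHermitian) (hAn : ∀ m, (An m).IsHermitian)
    (hPSD : ∀ m, ∀ v : Fin n → ℂ, 0 ≤ (star v ⬝ᵥ Ap m *ᵥ v).re)
    (hNSD : ∀ m, ∀ v : Fin n → ℂ, (star v ⬝ᵥ An m *ᵥ v).re ≤ 0)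
    (c : Fin M → ℝ) (x z : Fin n → ℂ) (s : Fin M → ℝ)
    (hs : ∀ m, 0 ≤ s m)
    (hfeas : ∀ m, (star x ⬝ᵥ Ap m *ᵥ x).re + 2 * (star z ⬝ᵥ An m *ᵥ x).re
        ≤ c m + (star z ⬝ᵥ An m *ᵥ z).re + s m) :
    ∀ m, (star x ⬝ᵥ Ap m *ᵥ x).re + 2 * (star x ⬝ᵥ An m *ᵥ x).re
        ≤ c m + (star x ⬝ᵥ An m *ᵥ x).re + s m := by
  intro m
  have h1 := hNSD m (x - z)
  have h2 : (star x ⬝ᵥ An m *ᵥ z).re = (star z ⬝ᵥ An m *ᵥ x).re := by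
    have h3 : star (star z ⬝ᵥ An m *ᵥ x) = star x ⬝ᵥ An m *ᵥ z := by
      rw [Matrix.star_dotProduct, star_star, star_mulVec, (hAn m).eq, ← dotProduct_mulVec]
    rw [← h3]
    simp
  have h4 := hfeas m
  simp only [star_sub, mulVec_sub, sub_dotProduct, dotProduct_sub, Complex.sub_re] at h1
  linarith
end

section
/- Fix a Hermitian positive semidefinite matrix A₀ ∈ ℂⁿˣⁿ, Hermitian matrices A₁,…,A_M ∈ ℂⁿˣⁿ with decompositions Aₘ = Aₘ⁺ + Aₘ⁻ (Aₘ⁺ Hermitian PSD, Aₘ⁻ Hermitian NSD), c ∈ ℝᴹ, and λ ≥ 0. For z ∈ ℂⁿ let F(z) ⊆ ℂⁿ × ℝᴹ denote the feasible set of the subproblem Π₃ linearized around z, i.e., all (x, s) with sₘ ≥ 0 and Re(xᴴ Aₘ⁺ x) + 2 Re(zᴴ Aₘ⁻ x) ≤ cₘ + Re(zᴴ Aₘ⁻ z) + sₘ for all m, and let J(x, s) = Re(xᴴ A₀ x) + λ Σₘ sₘ. If (x, s) ∈ F(z), then the infimum of J over F(x) is at most J(x, s). Consequently the optimal values of the successive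 FPP-SCA subproblems form a non-increasing sequence. -/
open Matrix

/-- If `(x, s)` is feasible for the FPP-SCA subproblem linearized around `z`,
then the optimal value of the subproblem linearized around `x` is at most the
objective value at `(x, s)`; hence the optimal values of successive FPP-SCA
subproblems are non-increasing. -/
theorem fpp_sca_cost_nonincreasing {n M : ℕ}
    (A0 : Matrix (Fin n) (Fin n) ℂ) (hA0 : A0.IsHermitian)
    (hA0psd : ∀ v : Fin n → ℂ, 0 ≤ (star v ⬝ᵥ A0 *ᵥ v).re)
    (Ap An : Fin M → Matrix (Fin n) (Fin n) ℂ)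
    (hAp : ∀ m, (Ap m).IsHermitian) (hAn : ∀ m, (An m).IsHermitian)
    (hPSD : ∀ m, ∀ v : Fin n → ℂ, 0 ≤ (star v ⬝ᵥ Ap m *ᵥ v).re)
    (hNSD : ∀ m, ∀ v : Fin n → ℂ, (star v ⬝ᵥ An m *ᵥ v).re ≤ 0)
    (c : Fin M → ℝ) (lam : ℝ) (hlam : 0 ≤ lam)
    -- the feasible set of the subproblem `Π₃` linearized around `z`
    (F : (Fin n → ℂ) → Set ((Fin n → ℂ) × (Fin M → ℝ)))
    (hF : ∀ z, F z = {p | (∀ m, 0 ≤ p.2 m) ∧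
      ∀ m, (star p.1 ⬝ᵥ Ap m *ᵥ p.1).re + 2 * (star z ⬝ᵥ An m *ᵥ p.1).re
          ≤ c m + (star z ⬝ᵥ An m *ᵥ z).re + p.2 m})
    -- the objective of `Π₃`
    (J : (Fin n → ℂ) × (Fin M → ℝ) → ℝ)
    (hJ : ∀ p, J p = (star p.1 ⬝ᵥ A0 *ᵥ p.1).re + lam * ∑ m, p.2 m)
    (z : Fin n → ℂ) (x : Fin n → ℂ) (s : Fin M → ℝ)
    (hxs : (x, s) ∈ F z) :
    sInf (J '' F x) ≤ J (x, s) := by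
  rw [hF] at hxs
  obtain ⟨hs, hc⟩ := hxs
  apply csInf_le
  · refine ⟨0, ?_⟩
    rintro _ ⟨p, hp, rfl⟩
    rw [hF] at hp
    rw [hJ]
    exact add_nonneg (hA0psd _) (mul_nonneg hlam (Finset.sum_nonneg fun m _ => hp.1 m))
  · refine ⟨(x, s), ?_, rfl⟩
    rw [hF]
    refine ⟨hs, fun m => ?_⟩
    have h1 := hc m
    have h2 := hNSD m (x - z)
    have h3 : (star x ⬝ᵥ An m *ᵥ z).re = (star z ⬝ᵥ An m *ᵥ x).re := by
      have h4 : star (star z ⬝ᵥ An m *ᵥ x) = star x ⬝ᵥ An m *ᵥ z := by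
        rw [Matrix.star_dotProduct, star_star, Matrix.star_mulVec, (hAn m).eq,
          Matrix.dotProduct_mulVec]
      rw [← h4]
      simp
    simp only [star_sub, Matrix.mulVec_sub, sub_dotProduct, dotProduct_sub,
      Complex.sub_re] at h2
    dsimp only at h1 ⊢
    linarith
end
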